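/- For every integer n ≥ 3, let c_n denote the number of permutations π ∈ S_n such that π avoids 312 and π² avoids 132, and for i ≥ 1 let a_i denote the number of permutations π ∈ S_i such that π avoids 312, π² avoids 132, and π_i = 1 (π ends in 1). Then c_n = a_n + Σ_{i=1}^{n−1} a_i · 2^{n−1−i}. -/

import Mathlib

/-- A permutation `π` of `Fin n` contains the pattern `τ` (a permutation of `Fin m`)
if there is a strictly increasing choice of `m` indices on which `π` is
order-isomorphic to `τ`. -/
def PermContains {n m : ℕ} (π : Equiv.Perm (Fin n)) (τ : Equiv.Perm (Fin m)) : Prop :=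
  ∃ f : Fin m → Fin n, StrictMono f ∧ ∀ i j : Fin m, τ i < τ j ↔ π (f i) < π (f j)

/-- `π` avoids the pattern `τ`. -/
def PermAvoids {n m : ℕ} (π : Equiv.Perm (Fin n)) (τ : Equiv.Perm (Fin m)) : Prop :=
  ¬ PermContains π τ

/-- The pattern 123 (one-line notation), as a permutation of `Fin 3`. -/
def p123 : Equiv.Perm (Fin 3) := ⟨![0,1,2], ![0,1,2], by decide, by decide⟩
/-- The pattern 132. -/
def p132 : Equiv.Perm (Fin 3) := ⟨![0,2,1], ![0,2,1], by decide, by decide⟩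
/-- The pattern 213. -/
def p213 : Equiv.Perm (Fin 3) := ⟨![1,0,2], ![1,0,2], by decide, by decide⟩
/-- The pattern 231. -/
def p231 : Equiv.Perm (Fin 3) := ⟨![1,2,0], ![2,0,1], by decide, by decide⟩
/-- The pattern 312. -/
def p312 : Equiv.Perm (Fin 3) := ⟨![2,0,1], ![1,2,0], by decide, by decide⟩
/-- The pattern 321. -/
def p321 : Equiv.Perm (Fin 3) := ⟨![2,1,0], ![2,1,0], by decide, by decide⟩

theorem permAvoids_p312_iff {n : ℕ} (π : Equiv.Perm (Fin n)) :
    PermAvoids π p312 ↔ ∀ x y z : Fin n, x < y → y < z → π y < π z → π z < π x → False := by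
  constructor
  · intro h x y z hxy hyz h1 h2
    refine h ⟨![x, y, z], ?_, ?_⟩
    · rw [Fin.strictMono_iff_lt_succ]
      intro i
      fin_cases i <;> simpa
    · intro i j
      have h3 := h1.trans h2
      fin_cases i <;> fin_cases j <;> simp [p312, h1, h2, h3, h1.le, h2.le, h3.le]
  · rintro h ⟨f, hf, hπ⟩
    exact h (f 0) (f 1) (f 2) (hf (by decide)) (hf (by decide))
      ((hπ 1 2).1 (by decide)) ((hπ 2 0).1 (by decide))

theorem permAvoids_p132_iff {n : ℕ} (π : Equiv.Perm (Fin n)) :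
    PermAvoids π p132 ↔ ∀ x y z : Fin n, x < y → y < z → π x < π z → π z < π y → False := by
  constructor
  · intro h x y z hxy hyz h1 h2
    refine h ⟨![x, y, z], ?_, ?_⟩
    · rw [Fin.strictMono_iff_lt_succ]
      intro i
      fin_cases i <;> simpa
    · intro i j
      have h3 := h1.trans h2
      fin_cases i <;> fin_cases j <;> simp [p132, h1, h2, h3, h1.le, h2.le, h3.le]
  · rintro h ⟨f, hf, hπ⟩
    exact h (f 0) (f 1) (f 2) (hf (by decide)) (hf (by decide))
      ((hπ 0 2).1 (by decide)) ((hπ 2 1).1 (by decide))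

/-- The direct sum of two permutations. -/
def permDirectSum {k m : ℕ} (σ : Equiv.Perm (Fin k)) (τ : Equiv.Perm (Fin m)) :
    Equiv.Perm (Fin (k + m)) :=
  finSumFinEquiv.permCongr (Equiv.Perm.sumCongr σ τ)

theorem permDirectSum_castAdd {k m : ℕ} (σ : Equiv.Perm (Fin k)) (τ : Equiv.Perm (Fin m))
    (x : Fin k) : permDirectSum σ τ (Fin.castAdd m x) = Fin.castAdd m (σ x) := by
  simp [permDirectSum, Equiv.permCongr_apply]

theorem permDirectSum_natAdd {k m : ℕ} (σ : Equiv.Perm (Fin k)) (τ : Equiv.Perm (Fin m))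
    (x : Fin m) : permDirectSum σ τ (Fin.natAdd k x) = Fin.natAdd k (τ x) := by
  simp [permDirectSum, Equiv.permCongr_apply]

theorem permDirectSum_inj {k m : ℕ} {σ σ' : Equiv.Perm (Fin k)} {τ τ' : Equiv.Perm (Fin m)}
    (h : permDirectSum σ τ = permDirectSum σ' τ') : σ = σ' ∧ τ = τ' := by
  constructor
  · ext x
    have := congrArg (fun f => (f (Fin.castAdd m x)).val) h
    simpa [permDirectSum_castAdd] using this
  · ext x
    have := congrArg (fun f => (f (Fin.natAdd k x)).val) h
    simpa [permDirectSum_natAdd] using this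

theorem permDirectSum_sq {k m : ℕ} (σ : Equiv.Perm (Fin k)) (τ : Equiv.Perm (Fin m)) :
    permDirectSum σ τ ^ 2 = permDirectSum (σ ^ 2) (τ ^ 2) := by
  ext x
  induction x using Fin.addCases <;>
    simp [sq, Equiv.Perm.mul_apply, permDirectSum_castAdd, permDirectSum_natAdd]

theorem permDirectSum_eq_one_iff {k m : ℕ} (σ : Equiv.Perm (Fin k)) (τ : Equiv.Perm (Fin m)) :
    permDirectSum σ τ = 1 ↔ σ = 1 ∧ τ = 1 := by
  constructor
  · intro h
    apply permDirectSum_inj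
    rw [h]
    ext x
    induction x using Fin.addCases <;> simp [permDirectSum_castAdd, permDirectSum_natAdd]
  · rintro ⟨rfl, rfl⟩
    ext x
    induction x using Fin.addCases <;> simp [permDirectSum_castAdd, permDirectSum_natAdd]

theorem permAvoids_p312_permDirectSum_iff {k m : ℕ} (σ : Equiv.Perm (Fin k))
    (τ : Equiv.Perm (Fin m)) :
    PermAvoids (permDirectSum σ τ) p312 ↔ PermAvoids σ p312 ∧ PermAvoids τ p312 := by
  simp only [permAvoids_p312_iff]
  constructor
  · intro h
    constructor
    · intro x y z
      have := h (Fin.castAdd m x) (Fin.castAdd m y) (Fin.castAdd m z)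
      simpa only [permDirectSum_castAdd, Fin.lt_def, Fin.val_castAdd] using this
    · intro x y z
      have := h (Fin.natAdd k x) (Fin.natAdd k y) (Fin.natAdd k z)
      simpa only [permDirectSum_natAdd, Fin.lt_def, Fin.val_natAdd,
        add_lt_add_iff_left] using this
  · rintro ⟨h1, h2⟩ x y z
    induction x using Fin.addCases with
    | left x =>
      induction y using Fin.addCases with
      | left y =>
        induction z using Fin.addCases with
        | left z =>
          have := h1 x y z
          simpa only [permDirectSum_castAdd, Fin.lt_def, Fin.val_castAdd] using this
        | right z =>
          simp only [permDirectSum_castAdd, permDirectSum_natAdd, Fin.lt_def,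
            Fin.val_castAdd, Fin.val_natAdd]
          omega
      | right y =>
        simp only [permDirectSum_castAdd, permDirectSum_natAdd, Fin.lt_def,
          Fin.val_castAdd, Fin.val_natAdd]
        omega
    | right x =>
      induction y using Fin.addCases with
      | left y =>
        simp only [Fin.lt_def, Fin.val_castAdd, Fin.val_natAdd]
        omega
      | right y =>
        induction z using Fin.addCases with
        | left z =>
          simp only [Fin.lt_def, Fin.val_castAdd, Fin.val_natAdd]
          omega
        | right z =>
          have := h2 x y z
          simpa only [permDirectSum_natAdd, Fin.lt_def, Fin.val_natAdd,
            add_lt_add_iff_left] using this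

theorem perm_eq_one_of_strictMono {m : ℕ} {τ : Equiv.Perm (Fin m)} (h : StrictMono τ) :
    τ = 1 := by
  have : (h.orderIsoOfSurjective τ τ.surjective) = OrderIso.refl _ := Subsingleton.elim _ _
  ext x
  exact congrArg (fun f => (f x).val) this

theorem permAvoids_p132_permDirectSum_iff {k m : ℕ} (σ : Equiv.Perm (Fin (k + 1)))
    (τ : Equiv.Perm (Fin m)) :
    PermAvoids (permDirectSum σ τ) p132 ↔ PermAvoids σ p132 ∧ τ = 1 := by
  simp only [permAvoids_p132_iff]
  constructor
  · intro h
    constructor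
    · intro x y z
      have := h (Fin.castAdd m x) (Fin.castAdd m y) (Fin.castAdd m z)
      simpa only [permDirectSum_castAdd, Fin.lt_def, Fin.val_castAdd] using this
    · apply perm_eq_one_of_strictMono
      intro y z hyz
      by_contra hcon
      have hne : τ y ≠ τ z := fun e => hyz.ne (τ.injective e)
      have hlt : τ z < τ y := lt_of_le_of_ne (not_lt.1 hcon) hne.symm
      have := h (Fin.castAdd m 0) (Fin.natAdd (k + 1) y) (Fin.natAdd (k + 1) z)
      simp only [permDirectSum_castAdd, permDirectSum_natAdd, Fin.lt_def,
        Fin.val_castAdd, Fin.val_natAdd] at this hlt hyz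
      have h0 := (σ 0).isLt
      have h1 := (0 : Fin (k + 1)).isLt
      exact this (by omega) (by omega) (by omega) (by omega)
  · rintro ⟨h1, rfl⟩ x y z
    induction y using Fin.addCases with
    | left y =>
      induction x using Fin.addCases with
      | left x =>
        induction z using Fin.addCases with
        | left z =>
          have := h1 x y z
          simpa only [permDirectSum_castAdd, Fin.lt_def, Fin.val_castAdd] using this
        | right z =>
          simp only [permDirectSum_castAdd, permDirectSum_natAdd, Fin.lt_def,
            Fin.val_castAdd, Fin.val_natAdd]
          omega
      | right x =>
        simp only [Fin.lt_def, Fin.val_castAdd, Fin.val_natAdd]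
        omega
    | right y =>
      induction z using Fin.addCases with
      | left z =>
        simp only [Fin.lt_def, Fin.val_castAdd, Fin.val_natAdd]
        omega
      | right z =>
        simp only [permDirectSum_natAdd, Fin.lt_def, Fin.val_natAdd, Equiv.Perm.one_apply]
        omega

theorem exists_permDirectSum_of_permAvoids {i m : ℕ} {π : Equiv.Perm (Fin (i + 1 + m))}
    (hπ : PermAvoids π p312) (h0 : (π (Fin.castAdd m (Fin.last i))).val = 0) :
    ∃ (σ : Equiv.Perm (Fin (i + 1))) (τ : Equiv.Perm (Fin m)), permDirectSum σ τ = π := by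
  rw [permAvoids_p312_iff] at hπ
  have hlt : ∀ (x : Fin (i + 1)) (y : Fin m),
      π (Fin.castAdd m x) < π (Fin.natAdd (i + 1) y) := by
    intro x y
    have hy : (π (Fin.natAdd (i + 1) y)).val ≠ 0 := by
      intro h
      have := congrArg Fin.val (π.injective (Fin.ext (h.trans h0.symm)))
      simp at this
      omega
    rcases (Fin.le_last x).lt_or_eq with hx | rfl
    · by_contra hcon
      refine hπ (Fin.castAdd m x) (Fin.castAdd m (Fin.last i)) (Fin.natAdd (i + 1) y)
        (by simpa [Fin.lt_def] using hx) (by simp [Fin.lt_def]; omega) ?_ ?_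
      · rw [Fin.lt_def]; omega
      · refine lt_of_le_of_ne (not_lt.1 hcon) fun e => ?_
        have := congrArg Fin.val (π.injective e)
        simp at this
        omega
    · rw [Fin.lt_def]; omega
  have hmaps : ∀ x : Fin (i + 1), (π (Fin.castAdd m x)).val < i + 1 := by
    intro x
    by_contra hcon
    have hcard := Finset.card_le_card_of_injOn (s := (Finset.univ : Finset (Fin m)))
      (t := Finset.Ioi (π (Fin.castAdd m x))) (fun y => π (Fin.natAdd (i + 1) y))
      (fun y _ => by simpa using hlt x y)
      (fun y _ z _ h => by simpa using h)
    simp at hcard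
    omega
  have hrange : finSumFinEquiv.symm.permCongr π ∈
      (Equiv.Perm.sumCongrHom (Fin (i + 1)) (Fin m)).range := by
    apply Equiv.Perm.mem_sumCongrHom_range_of_perm_mapsTo_inl
    rintro _ ⟨x, rfl⟩
    refine ⟨⟨_, hmaps x⟩, ?_⟩
    apply finSumFinEquiv.injective
    ext
    simp [Equiv.permCongr_apply]
  obtain ⟨⟨σ, τ⟩, h⟩ := hrange
  refine ⟨σ, τ, ?_⟩
  change finSumFinEquiv.permCongr (Equiv.Perm.sumCongrHom _ _ (σ, τ)) = π
  rw [h]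
  ext x
  simp [Equiv.permCongr_apply]

theorem card_eq_sum_card_mul_card (P Q R : ∀ n : ℕ, Equiv.Perm (Fin n) → Prop)
    (hP : ∀ n π, P n π → PermAvoids π p312)
    (hPQR : ∀ k m (σ : Equiv.Perm (Fin (k + 1))) (τ : Equiv.Perm (Fin m)),
      P _ (permDirectSum σ τ) ↔ Q _ σ ∧ R _ τ) (n : ℕ) :
    Nat.card {π : Equiv.Perm (Fin (n + 1)) // P _ π} =
      ∑ i : Fin (n + 1),
        Nat.card {σ : Equiv.Perm (Fin (i + 1)) // Q _ σ ∧ σ (Fin.last i) = 0} *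
        Nat.card {τ : Equiv.Perm (Fin (n - i)) // R _ τ} := by
  have key : ∀ i m N (hN : i + 1 + m = N) (x : Fin N) (_ : x.val = i),
      Nat.card {π : Equiv.Perm (Fin N) // P _ π ∧ (π x).val = 0} =
      Nat.card {σ : Equiv.Perm (Fin (i + 1)) // Q _ σ ∧ σ (Fin.last i) = 0} *
        Nat.card {τ : Equiv.Perm (Fin m) // R _ τ} := by
    rintro i m _ rfl x hx
    obtain rfl : x = Fin.castAdd m (Fin.last i) := by ext; simpa using hx
    rw [← Nat.card_prod]
    symm
    refine Nat.card_congr (Equiv.ofBijective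
      (fun p => ⟨permDirectSum p.1.1 p.2.1, (hPQR _ _ _ _).2 ⟨p.1.2.1, p.2.2⟩, ?_⟩) ⟨?_, ?_⟩)
    · rw [permDirectSum_castAdd, p.1.2.2]; simp
    · rintro ⟨⟨σ, _⟩, ⟨τ, _⟩⟩ ⟨⟨σ', _⟩, ⟨τ', _⟩⟩ h
      obtain ⟨rfl, rfl⟩ := permDirectSum_inj (congrArg Subtype.val h)
      rfl
    · rintro ⟨π, hπ, h0⟩
      obtain ⟨σ, τ, rfl⟩ := exists_permDirectSum_of_permAvoids (hP _ _ hπ) h0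
      obtain ⟨hq, hr⟩ := (hPQR _ _ _ _).1 hπ
      refine ⟨⟨⟨σ, hq, ?_⟩, ⟨τ, hr⟩⟩, rfl⟩
      rw [permDirectSum_castAdd] at h0
      ext
      simpa using h0
  rw [Nat.card_congr (Equiv.sigmaFiberEquiv
    (fun π : {π : Equiv.Perm (Fin (n + 1)) // P _ π} => π.1.symm 0)).symm, Nat.card_sigma]
  refine Finset.sum_congr rfl fun i _ => ?_
  rw [← key i (n - i) (n + 1) (by omega) i rfl]
  refine Nat.card_congr ((Equiv.subtypeSubtypeEquivSubtypeInter _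
    (fun π : Equiv.Perm (Fin (n + 1)) => π.symm 0 = i)).trans
    (Equiv.subtypeEquivRight fun π => and_congr_right fun _ => ?_))
  rw [Equiv.symm_apply_eq, eq_comm, Fin.ext_iff, Fin.val_zero]

theorem card_involution_last_eq_zero (i : ℕ) :
    Nat.card {σ : Equiv.Perm (Fin (i + 1)) //
      (PermAvoids σ p312 ∧ σ ^ 2 = 1) ∧ σ (Fin.last i) = 0} = 1 := by
  rw [Nat.card_eq_one_iff_exists]
  refine ⟨⟨Fin.revPerm, ⟨?_, ?_⟩, ?_⟩, ?_⟩
  · rw [permAvoids_p312_iff]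
    intro x y z _ hyz h _
    simp only [Fin.revPerm_apply, Fin.rev_lt_rev] at h
    exact hyz.asymm h
  · ext x; simp [sq]
  · simp
  · rintro ⟨σ, ⟨hav, hsq⟩, h0⟩
    rw [permAvoids_p312_iff] at hav
    have hinv : ∀ x, σ (σ x) = x := fun x => by
      have := congrArg (fun f => f x) hsq
      simpa [sq] using this
    have hz : σ 0 = Fin.last i := by rw [← h0, hinv]
    have hanti : StrictAnti σ := by
      intro x y hxy
      by_contra hcon
      have hne : σ x ≠ σ y := fun e => hxy.ne (σ.injective e)
      have hlt : σ x < σ y := lt_of_le_of_ne (not_lt.1 hcon) hne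
      rcases (Fin.zero_le x).lt_or_eq with hx | rfl
      · refine hav 0 x y hx hxy hlt ?_
        rw [hz]
        refine lt_of_le_of_ne (Fin.le_last _) fun e => ?_
        rw [← hz] at e
        exact (hx.trans hxy).ne' (σ.injective e)
      · rw [hz] at hlt
        exact absurd hlt (not_lt.2 (Fin.le_last _))
    have h1 : σ.trans Fin.revPerm = 1 :=
      perm_eq_one_of_strictMono fun x y hxy => by simpa using hanti hxy
    apply Subtype.ext
    ext x : 1
    have := congrArg (fun f => f x) h1
    simp only [Equiv.trans_apply, Fin.revPerm_apply, Equiv.Perm.one_apply] at this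
    change σ x = Fin.rev x
    rw [← this, Fin.rev_rev, this]

theorem card_involution_permAvoids_p312_zero :
    Nat.card {τ : Equiv.Perm (Fin 0) // PermAvoids τ p312 ∧ τ ^ 2 = 1} = 1 := by
  rw [Nat.card_eq_one_iff_exists]
  refine ⟨⟨1, ?_, one_pow 2⟩, fun τ => Subsingleton.elim _ _⟩
  rw [permAvoids_p312_iff]
  exact fun x => x.elim0

theorem card_involution_permAvoids_p312 (n : ℕ) :
    Nat.card {τ : Equiv.Perm (Fin (n + 1)) // PermAvoids τ p312 ∧ τ ^ 2 = 1} = 2 ^ n := by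
  induction n using Nat.strong_induction_on with
  | _ n ih =>
  rw [card_eq_sum_card_mul_card (fun _ τ => PermAvoids τ p312 ∧ τ ^ 2 = 1)
    (fun _ τ => PermAvoids τ p312 ∧ τ ^ 2 = 1) (fun _ τ => PermAvoids τ p312 ∧ τ ^ 2 = 1)
    (fun _ _ h => h.1) (fun k m σ τ => by
      rw [permAvoids_p312_permDirectSum_iff, permDirectSum_sq, permDirectSum_eq_one_iff]
      tauto)]
  simp only [card_involution_last_eq_zero, one_mul]
  rw [Fin.sum_univ_eq_sum_range (fun i => Nat.card {τ : Equiv.Perm (Fin (n - i)) //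
      PermAvoids τ p312 ∧ τ ^ 2 = 1}) (n + 1),
    Finset.sum_flip (fun i => Nat.card {τ : Equiv.Perm (Fin i) //
      PermAvoids τ p312 ∧ τ ^ 2 = 1}),
    Finset.sum_range_succ', card_involution_permAvoids_p312_zero,
    Finset.sum_congr rfl fun i hi => ih i (Finset.mem_range.1 hi)]
  rw [Nat.geomSum_eq le_rfl, Nat.add_one_sub_one, Nat.div_one,
    Nat.sub_add_cancel Nat.one_le_two_pow]

theorem stmt7 (n : ℕ) (hn : 3 ≤ n) (c a : ℕ → ℕ)
    (hc : ∀ m : ℕ, c m = Nat.card {π : Equiv.Perm (Fin m) //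
      PermAvoids π p312 ∧ PermAvoids (π ^ 2) p132})
    (ha : ∀ m : ℕ, a (m + 1) = Nat.card {π : Equiv.Perm (Fin (m + 1)) //
      (PermAvoids π p312 ∧ PermAvoids (π ^ 2) p132) ∧ π (Fin.last m) = 0}) :
    c n = a n + ∑ i ∈ Finset.Icc 1 (n - 1), a i * 2 ^ (n - 1 - i) := by
  obtain ⟨n, rfl⟩ : ∃ k, n = k + 1 := ⟨n - 1, by omega⟩
  rw [hc, card_eq_sum_card_mul_card
    (fun k π => PermAvoids π p312 ∧ PermAvoids (π ^ 2 : Equiv.Perm (Fin k)) p132)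
    (fun k σ => PermAvoids σ p312 ∧ PermAvoids (σ ^ 2 : Equiv.Perm (Fin k)) p132)
    (fun _ τ => PermAvoids τ p312 ∧ τ ^ 2 = 1)
    (fun _ _ h => h.1) (fun k m σ τ => by
      rw [permAvoids_p312_permDirectSum_iff, permDirectSum_sq, permAvoids_p132_permDirectSum_iff]
      tauto) n]
  obtain ⟨b, hb⟩ : ∃ b : ℕ → ℕ, ∀ m, Nat.card {τ : Equiv.Perm (Fin m) //
      PermAvoids τ p312 ∧ τ ^ 2 = 1} = b m := ⟨_, fun _ => rfl⟩
  have hb_zero : b 0 = 1 := by rw [← hb, card_involution_permAvoids_p312_zero]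
  have hb_succ : ∀ m, b (m + 1) = 2 ^ m := fun m => by rw [← hb, card_involution_permAvoids_p312]
  simp only [← ha, hb]
  rw [Fin.sum_univ_eq_sum_range (fun i => a (i + 1) * b (n - i)) (n + 1),
    Finset.sum_range_succ, Nat.sub_self, hb_zero, mul_one, add_comm, Nat.add_sub_cancel,
    ← Finset.Ico_add_one_right_eq_Icc, Finset.sum_Ico_eq_sum_range, Nat.add_sub_cancel]
  congr 1
  refine Finset.sum_congr rfl fun i hi => ?_
  obtain ⟨k, rfl⟩ := Nat.exists_eq_add_of_lt (Finset.mem_range.1 hi)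
  rw [show i + k + 1 - i = k + 1 by omega, show i + k + 1 - (1 + i) = k by omega,
    hb_succ, add_comm i 1]
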